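/- arXiv:1605.07255 — 2 statements merged into one kernel-verified Lean document; each statement's English description precedes it below -/
import Mathlib

section
/- Let n ≥ 2 be an integer, let κ and μ be real constants, and let δ > 0 be such that c_κ(s) > 0 for all s ∈ (-δ, δ). Suppose Φ : ℝ → ℝ is twice differentiable on (-δ, δ) with Φ(0) = 0 and Φ'(0) = 1, and suppose Φ satisfies Φ''(s) + (n-1)·(c_κ'(s)/c_κ(s))·Φ'(s) + μ·Φ(s) = 0 for all s ∈ (-δ, δ). Then the quotient Φ''(s)/Φ(s) tends to (n-1)·κ - μ as s tends to 0 (through nonzero values). -/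
open Set Filter Topology

/-- For a real constant `κ`, `ck κ t = cos (√κ · t)` if `κ > 0`, `1` if `κ = 0`,
and `cosh (√|κ| · t)` if `κ < 0`. -/
noncomputable def ck (κ : ℝ) (t : ℝ) : ℝ :=
  if 0 < κ then Real.cos (Real.sqrt κ * t)
  else if κ = 0 then 1
  else Real.cosh (Real.sqrt |κ| * t)

theorem ck_zero (κ : ℝ) : ck κ 0 = 1 := by
  unfold ck
  split_ifs <;> simp

theorem differentiable_ck (κ : ℝ) : Differentiable ℝ (ck κ) := by
  unfold ck
  split_ifs <;> fun_prop

theorem deriv_ck (κ t : ℝ) :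
    deriv (ck κ) t =
      if 0 < κ then -(√κ * Real.sin (√κ * t))
      else if κ = 0 then 0
      else √|κ| * Real.sinh (√|κ| * t) := by
  have hlin (a : ℝ) : HasDerivAt (fun t : ℝ => a * t) a t := by
    simpa using (hasDerivAt_id t).const_mul a
  unfold ck
  split_ifs
  · rw [(hlin (√κ)).cos.deriv]
    ring
  · simp
  · rw [(hlin (√|κ|)).cosh.deriv]
    ring

theorem hasDerivAt_deriv_ck_zero (κ : ℝ) : HasDerivAt (deriv (ck κ)) (-κ) 0 := by
  have hlin (a : ℝ) : HasDerivAt (fun t : ℝ => a * t) a 0 := by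
    simpa using (hasDerivAt_id (0 : ℝ)).const_mul a
  rw [funext (deriv_ck κ)]
  split_ifs with hpos hzero
  · refine ((hlin (√κ)).sin.const_mul (√κ)).fun_neg.congr_deriv ?_
    simp [Real.mul_self_sqrt hpos.le]
  · simpa [hzero] using hasDerivAt_const (0 : ℝ) (0 : ℝ)
  · refine ((hlin (√|κ|)).sinh.const_mul (√|κ|)).congr_deriv ?_
    simp [abs_of_nonpos (not_lt.mp hpos), Real.mul_self_sqrt (neg_nonneg.mpr (not_lt.mp hpos))]

theorem deriv_ck_zero (κ : ℝ) : deriv (ck κ) 0 = 0 := by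
  simp [deriv_ck]

theorem HasDerivAt.tendsto_div_self_zero {f : ℝ → ℝ} {a : ℝ} (hf : HasDerivAt f a 0)
    (h0 : f 0 = 0) : Tendsto (fun s => f s / s) (𝓝[≠] 0) (𝓝 a) := by
  refine hf.tendsto_slope.congr fun s => ?_
  simp [slope_def_field, h0]

/-- if `Φ` is twice differentiable on `(-δ, δ)`, `Φ(0) = 0`, `Φ'(0) = 1`,
and `Φ'' + (n-1)(c_κ'/c_κ)Φ' + μΦ = 0` on `(-δ, δ)` (where `c_κ > 0` on `(-δ, δ)`),
then `Φ''(s)/Φ(s) → (n-1)κ - μ` as `s → 0`, `s ≠ 0`. -/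
theorem sturm_liouville_limit (n : ℕ) (hn : 2 ≤ n) (κ μ δ : ℝ) (hδ : 0 < δ)
    (hck : ∀ s ∈ Ioo (-δ) δ, 0 < ck κ s)
    (Φ : ℝ → ℝ)
    (hΦ : ∀ s ∈ Ioo (-δ) δ, DifferentiableAt ℝ Φ s)
    (hΦ' : ∀ s ∈ Ioo (-δ) δ, DifferentiableAt ℝ (deriv Φ) s)
    (hΦ0 : Φ 0 = 0) (hΦ'0 : deriv Φ 0 = 1)
    (hode : ∀ s ∈ Ioo (-δ) δ,
      deriv (deriv Φ) s + (n - 1 : ℝ) * (deriv (ck κ) s / ck κ s) * deriv Φ s + μ * Φ s = 0) :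
    Tendsto (fun s => deriv (deriv Φ) s / Φ s) (𝓝[≠] 0) (𝓝 ((n - 1 : ℝ) * κ - μ)) := by
  have h0 : (0 : ℝ) ∈ Ioo (-δ) δ := ⟨neg_lt_zero.mpr hδ, hδ⟩
  have hΦs : Tendsto (fun s => Φ s / s) (𝓝[≠] 0) (𝓝 1) :=
    (hΦ'0 ▸ (hΦ 0 h0).hasDerivAt).tendsto_div_self_zero hΦ0
  have hcs : Tendsto (fun s => deriv (ck κ) s / s) (𝓝[≠] 0) (𝓝 (-κ)) :=
    (hasDerivAt_deriv_ck_zero κ).tendsto_div_self_zero (deriv_ck_zero κ)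
  have hc : Tendsto (ck κ) (𝓝[≠] 0) (𝓝 1) :=
    ck_zero κ ▸ (differentiable_ck κ).continuous.continuousAt.tendsto.mono_left
      nhdsWithin_le_nhds
  have hdΦ : Tendsto (deriv Φ) (𝓝[≠] 0) (𝓝 1) :=
    hΦ'0 ▸ (hΦ' 0 h0).continuousAt.tendsto.mono_left nhdsWithin_le_nhds
  have hlim := ((((hcs.div hc one_ne_zero).const_mul (n - 1 : ℝ)).mul hdΦ).div hΦs
    one_ne_zero).neg.sub_const μ
  have hvalue : -((n - 1 : ℝ) * (-κ / 1) * 1 / 1) - μ = (n - 1 : ℝ) * κ - μ := by ring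
  rw [hvalue] at hlim
  refine hlim.congr' ?_
  filter_upwards [self_mem_nhdsWithin, nhdsWithin_le_nhds (Ioo_mem_nhds h0.1 h0.2),
    hΦs.eventually_ne one_ne_zero] with s hs hmem hne
  have hs0 : s ≠ 0 := hs
  have hΦne : Φ s ≠ 0 := fun h => hne (by simp [h])
  have hcne := (hck s hmem).ne'
  have hode_s : deriv (deriv Φ) s =
      -((n - 1 : ℝ) * (deriv (ck κ) s / ck κ s) * deriv Φ s) - μ * Φ s := by
    linarith [hode s hmem]
  rw [hode_s]
  simp only [Pi.div_apply]
  field_simp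
end

section
/- Let p be a real number with 1 < p < 2, let n ≥ 2 be an integer, let κ be a real constant, let μ > 0, and let δ > 0 be such that c_κ(s) > 0 for all s ∈ [0, δ). Suppose Φ : ℝ → ℝ is continuously differentiable on [0, δ) and twice differentiable on (0, δ), with Φ(0) = 0 and Φ'(0) = 1, and satisfies the one-dimensional p-Laplacian eigenvalue equation (p-1)·|Φ'(s)|^{p-2}·Φ''(s) + (n-1)·(c_κ'(s)/c_κ(s))·|Φ'(s)|^{p-2}·Φ'(s) + μ·|Φ(s)|^{p-2}·Φ(s) = 0 for all s ∈ (0, δ). Then Φ''(s)/Φ(s) tends to -∞ as s tends to 0 from the right. -/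
open Set Filter Topology

theorem contDiff_ck (κ : ℝ) : ContDiff ℝ 2 (ck κ) := by
  unfold ck
  split_ifs
  · fun_prop
  · fun_prop
  · fun_prop

theorem exists_tendsto_deriv_ck_div (κ : ℝ) :
    ∃ L, Tendsto (fun s => deriv (ck κ) s / s) (𝓝[>] (0:ℝ)) (𝓝 L) := by
  have hd : Differentiable ℝ (deriv (ck κ)) :=
    ((contDiff_ck κ).deriv' (n := 1)).differentiable one_ne_zero
  refine ⟨deriv (deriv (ck κ)) 0, ?_⟩
  have h := (hd 0).hasDerivAt.tendsto_slope.mono_left (nhdsGT_le_nhdsNE 0)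
  refine h.congr fun s => ?_
  simp [slope_def_field, deriv_ck_zero]

/-- for `1 < p < 2`, if `Φ` is `C¹` on `[0, δ)` (with derivative `Φ'`),
twice differentiable on `(0, δ)` (with second derivative `Φ''`), `Φ(0) = 0`, `Φ'(0) = 1`,
and satisfies the one-dimensional `p`-Laplacian eigenvalue equation
`(p-1)|Φ'|^{p-2}Φ'' + (n-1)(c_κ'/c_κ)|Φ'|^{p-2}Φ' + μ|Φ|^{p-2}Φ = 0` on `(0, δ)`,
then `Φ''(s)/Φ(s) → -∞` as `s → 0⁺`. -/
theorem p_laplacian_model_blowup (p : ℝ) (hp1 : 1 < p) (hp2 : p < 2)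
    (n : ℕ) (hn : 2 ≤ n) (κ μ : ℝ) (hμ : 0 < μ) (δ : ℝ) (hδ : 0 < δ)
    (hck : ∀ s ∈ Ico (0:ℝ) δ, 0 < ck κ s)
    (Φ Φ' Φ'' : ℝ → ℝ)
    (hΦ' : ∀ s ∈ Ico (0:ℝ) δ, HasDerivWithinAt Φ (Φ' s) (Ico (0:ℝ) δ) s)
    (hΦ'cont : ContinuousOn Φ' (Ico (0:ℝ) δ))
    (hΦ'' : ∀ s ∈ Ioo (0:ℝ) δ, HasDerivAt Φ' (Φ'' s) s)
    (hΦ0 : Φ 0 = 0) (hΦ'0 : Φ' 0 = 1)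
    (hode : ∀ s ∈ Ioo (0:ℝ) δ,
      (p - 1) * |Φ' s| ^ (p - 2) * Φ'' s
        + (n - 1 : ℝ) * (deriv (ck κ) s / ck κ s) * (|Φ' s| ^ (p - 2) * Φ' s)
        + μ * (|Φ s| ^ (p - 2) * Φ s) = 0) :
    Tendsto (fun s => Φ'' s / Φ s) (𝓝[>] (0:ℝ)) atBot := by
  have hIoo : ∀ᶠ s in 𝓝[>] (0:ℝ), s ∈ Ioo (0:ℝ) δ := Ioo_mem_nhdsGT hδ
  have hle : 𝓝[>] (0:ℝ) ≤ 𝓝[Ico 0 δ] 0 :=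
    nhdsWithin_le_of_mem (mem_of_superset hIoo Ioo_subset_Ico_self)
  have h0 : (0:ℝ) ∈ Ico (0:ℝ) δ := ⟨le_rfl, hδ⟩
  have hD : Tendsto Φ' (𝓝[>] (0:ℝ)) (𝓝 1) := by
    simpa [hΦ'0] using (hΦ'cont 0 h0).tendsto.mono_left hle
  have hquot : Tendsto (fun s => Φ s / s) (𝓝[>] (0:ℝ)) (𝓝 1) := by
    have h := hasDerivWithinAt_iff_tendsto_slope.1 (hΦ' 0 h0)
    rw [hΦ'0] at h
    have hle' : 𝓝[>] (0:ℝ) ≤ 𝓝[Ico 0 δ \ {0}] 0 :=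
      nhdsWithin_le_of_mem (mem_of_superset hIoo fun s hs => ⟨⟨hs.1.le, hs.2⟩, hs.1.ne'⟩)
    refine (h.mono_left hle').congr fun s => ?_
    simp [slope_def_field, hΦ0]
  have hpos : ∀ᶠ s in 𝓝[>] (0:ℝ), 0 < Φ s := by
    filter_upwards [hIoo, hquot.eventually_const_lt one_pos] with s hs h
    exact (div_pos_iff_of_pos_right hs.1).1 h
  have hDpos : ∀ᶠ s in 𝓝[>] (0:ℝ), 0 < Φ' s := hD.eventually_const_lt one_pos
  have hΦlim : Tendsto Φ (𝓝[>] (0:ℝ)) (𝓝[>] 0) := by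
    refine tendsto_nhdsWithin_iff.2 ⟨?_, hpos⟩
    simpa [hΦ0] using (hΦ' 0 h0).continuousWithinAt.tendsto.mono_left hle
  obtain ⟨L, hL⟩ := exists_tendsto_deriv_ck_div κ
  have hc : Tendsto (ck κ) (𝓝[>] (0:ℝ)) (𝓝 (ck κ 0)) :=
    ((contDiff_ck κ).continuous.tendsto 0).mono_left nhdsWithin_le_nhds
  have hA := (((hL.div hquot one_ne_zero).div hc (hck 0 h0).ne').mul hD).const_mul
    ((n - 1 : ℝ) / (p - 1))
  have hp : 0 < p - 1 := sub_pos.2 hp1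
  have hB : Tendsto (fun s => μ / (p - 1) * Φ' s ^ (2 - p) * Φ s ^ (p - 2))
      (𝓝[>] (0:ℝ)) atTop := by
    have h1 : Tendsto (fun s => μ / (p - 1) * Φ' s ^ (2 - p)) (𝓝[>] (0:ℝ))
        (𝓝 (μ / (p - 1))) := by
      simpa using (hD.rpow_const (p := 2 - p) (Or.inl one_ne_zero)).const_mul (μ / (p - 1))
    exact h1.pos_mul_atTop (div_pos hμ hp)
      ((tendsto_rpow_neg_nhdsGT_zero (by linarith)).comp hΦlim)
  refine (tendsto_neg_atTop_atBot.comp (hA.add_atTop hB)).congr' ?_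
  filter_upwards [hIoo, hpos, hDpos] with s hs hP hQ
  have hode' := hode s hs
  have hcs := (hck s ⟨hs.1.le, hs.2⟩).ne'
  have hs0 := hs.1.ne'
  rw [abs_of_pos hP, abs_of_pos hQ] at hode'
  have hinv : Φ' s ^ (2 - p) * Φ' s ^ (p - 2) = 1 := by
    rw [← Real.rpow_add hQ]
    simp
  have hsecond : (p - 1) * Φ'' s = -((n - 1 : ℝ) * (deriv (ck κ) s / ck κ s) * Φ' s
      + μ * Φ' s ^ (2 - p) * Φ s ^ (p - 2) * Φ s) := by
    linear_combination Φ' s ^ (2 - p) * hode'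
      - ((p - 1) * Φ'' s + (n - 1 : ℝ) * (deriv (ck κ) s / ck κ s) * Φ' s) * hinv
  have hΦ''s : Φ'' s = -((n - 1 : ℝ) * (deriv (ck κ) s / ck κ s) * Φ' s
      + μ * Φ' s ^ (2 - p) * Φ s ^ (p - 2) * Φ s) / (p - 1) := by
    rw [eq_div_iff hp.ne', mul_comm]
    exact hsecond
  rw [hΦ''s]
  simp only [Function.comp_apply, Pi.div_apply]
  field_simp
end
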